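/- arXiv:1302.3660 — 4 statements merged into one kernel-verified Lean document; each statement's English description precedes it below -/
import Mathlib

section
/- Let λ ≥ 0 and let ν be a probability measure on ℝ^k (the channel-noise law). For a probability measure μ on ℝ^m (the source law) define J_m(μ,ν) := inf over Borel measurable g : ℝ^m → ℝ^k and h : ℝ^k → ℝ^m of ∫∫ ‖x − h(g(x)+z)‖² dμ(x) dν(z) + λ·∫ ‖g(x)‖² dμ(x). Then J_m(·,ν) is concave in the source law: for all probability measures μ₁, μ₂ on ℝ^m and all p ∈ [0,1], J_m(p·μ₁ + (1−p)·μ₂, ν) ≥ p·J_m(μ₁,ν) + (1−p)·J_m(μ₂,ν). -/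
open MeasureTheory ProbabilityTheory
open scoped ENNReal NNReal

/-- The minimum Lagrangian cost of zero-delay source-channel coding with source law `μ`
on `ℝ^m` and channel-noise law `ν` on `ℝ^k`, with Lagrange multiplier `lam`. -/
noncomputable def Jm {m k : ℕ} (lam : ℝ)
    (μ : Measure (EuclideanSpace ℝ (Fin m))) (ν : Measure (EuclideanSpace ℝ (Fin k))) : ℝ≥0∞ :=
  ⨅ (g : {g : EuclideanSpace ℝ (Fin m) → EuclideanSpace ℝ (Fin k) // Measurable g})
    (h : {h : EuclideanSpace ℝ (Fin k) → EuclideanSpace ℝ (Fin m) // Measurable h}),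
    (∫⁻ x, ∫⁻ z, (‖x - h.1 (g.1 x + z)‖₊ : ℝ≥0∞) ^ 2 ∂ν ∂μ)
      + ENNReal.ofReal lam * ∫⁻ x, (‖g.1 x‖₊ : ℝ≥0∞) ^ 2 ∂μ

/-- Theorem 1 (source half): `J_m` is concave in the source law. -/
theorem Jm_concave_in_source {m k : ℕ} (lam : ℝ) (hlam : 0 ≤ lam)
    (ν : Measure (EuclideanSpace ℝ (Fin k))) [IsProbabilityMeasure ν]
    (μ₁ μ₂ : Measure (EuclideanSpace ℝ (Fin m)))
    [IsProbabilityMeasure μ₁] [IsProbabilityMeasure μ₂]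
    (p : ℝ≥0) (hp : p ≤ 1) :
    Jm lam (p • μ₁ + (1 - p) • μ₂) ν ≥
      (p : ℝ≥0∞) * Jm lam μ₁ ν + ((1 - p : ℝ≥0) : ℝ≥0∞) * Jm lam μ₂ ν := by
  refine le_iInf₂ fun g h => ?_
  have cost_le (μ : Measure (EuclideanSpace ℝ (Fin m))) : Jm lam μ ν ≤ _ := iInf₂_le g h
  refine (add_le_add (mul_le_mul_right (cost_le μ₁) _) (mul_le_mul_right (cost_le μ₂) _)).trans
    (le_of_eq ?_)
  simp only [lintegral_add_measure, lintegral_smul_measure, ENNReal.smul_def, smul_eq_mul]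
  ring
end

section
/- Let λ > 0 and k_e ≠ 0 be real numbers, and let ν be a probability measure on ℝ with all moments finite and ∫ z dν(z) = 0. Suppose h : ℝ → ℝ is a polynomial function satisfying, for Lebesgue-almost every x ∈ ℝ, the encoder stationarity condition with the linear encoder g(x) = k_e·x: λ·k_e·x = ∫ ( x − h(k_e·x + z) ) · h'(k_e·x + z) dν(z). Then h is linear: there exists a ∈ ℝ such that h(y) = a·y for all y ∈ ℝ. -/
open MeasureTheory ProbabilityTheory
open scoped ENNReal NNReal

/-- Averaging the translates of a polynomial over a probability measure with finite moments gives a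
polynomial with the same coefficients from the degree on. -/
theorem exists_polynomial_integral_eval_add
    (ν : Measure ℝ) [IsProbabilityMeasure ν]
    (hmom : ∀ n : ℕ, Integrable (fun z : ℝ => z ^ n) ν) (q : Polynomial ℝ) :
    ∃ Q : Polynomial ℝ, (∀ m, q.natDegree ≤ m → Q.coeff m = q.coeff m) ∧
      ∀ y, Integrable (fun z => q.eval (y + z)) ν ∧ ∫ z, q.eval (y + z) ∂ν = Q.eval y := by
  have taylor_sum (y z : ℝ) : q.eval (y + z) =
      ∑ k ∈ Finset.range (q.natDegree + 1), (q.hasseDeriv k).eval y * z ^ k := by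
    rw [add_comm, ← Polynomial.taylor_eval, Polynomial.eval_eq_sum_range,
      Polynomial.natDegree_taylor]
    simp only [Polynomial.taylor_coeff]
  have term_integrable (y : ℝ) (k : ℕ) :
      Integrable (fun z => (q.hasseDeriv k).eval y * z ^ k) ν := (hmom k).const_mul _
  refine ⟨∑ k ∈ Finset.range (q.natDegree + 1),
    Polynomial.C (∫ z, z ^ k ∂ν) * q.hasseDeriv k, fun m hm => ?_, fun y => ⟨?_, ?_⟩⟩
  · rw [Polynomial.finsetSum_coeff, Finset.sum_eq_single 0]
    · simp
    · intro k _ hk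
      rw [Polynomial.coeff_C_mul, Polynomial.hasseDeriv_coeff,
        Polynomial.coeff_eq_zero_of_natDegree_lt (by omega)]
      simp
    · simp
  · simp only [taylor_sum]
    exact integrable_finsetSum _ fun k _ => term_integrable y k
  · simp only [taylor_sum]
    rw [integral_finsetSum _ fun k _ => term_integrable y k, Polynomial.eval_finsetSum]
    refine Finset.sum_congr rfl fun k _ => ?_
    rw [integral_const_mul, Polynomial.eval_mul, Polynomial.eval_C, mul_comm]

/-- Lemma 5: if a polynomial decoder `h` satisfies the encoder stationarity condition
with a linear encoder `g(x) = k_e x` (for zero-mean noise with all moments finite),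
then `h` is linear. -/
theorem decoder_linear_of_encoder_linear
    (lam ke : ℝ) (hlam : 0 < lam) (hke : ke ≠ 0)
    (ν : Measure ℝ) [IsProbabilityMeasure ν]
    (hmom : ∀ n : ℕ, Integrable (fun z : ℝ => z ^ n) ν)
    (hmean : ∫ z, z ∂ν = 0)
    (p : Polynomial ℝ)
    (hstat : ∀ᵐ x ∂(volume : Measure ℝ),
      lam * (ke * x) =
        ∫ z, (x - p.eval (ke * x + z)) * p.derivative.eval (ke * x + z) ∂ν) :
    ∃ a : ℝ, ∀ y : ℝ, p.eval y = a * y := by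
  obtain ⟨D, hDcoeff, hD⟩ := exists_polynomial_integral_eval_add ν hmom p.derivative
  obtain ⟨S, hScoeff, hS⟩ := exists_polynomial_integral_eval_add ν hmom (p * p.derivative)
  have integral_eq (x : ℝ) :
      ∫ z, (x - p.eval (ke * x + z)) * p.derivative.eval (ke * x + z) ∂ν =
        x * D.eval (ke * x) - S.eval (ke * x) := by
    rw [← (hD _).2, ← (hS _).2, ← integral_const_mul,
      ← integral_sub ((hD _).1.const_mul x) (hS _).1]
    simp only [Polynomial.eval_mul, sub_mul]
  simp only [integral_eq] at hstat
  have stationary : (fun x : ℝ => lam * (ke * x)) =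
      fun x => x * D.eval (ke * x) - S.eval (ke * x) :=
    (Continuous.ae_eq_iff_eq volume (by fun_prop) (by fun_prop)).1 hstat
  by_cases hdeg : p.natDegree ≤ 1
  · obtain ⟨a, b, rfl⟩ := Polynomial.exists_eq_X_add_C_of_natDegree_le_one hdeg
    have hid : Integrable (fun z : ℝ => z) ν := by simpa using hmom 1
    have value (x : ℝ) : lam * (ke * x) = (x - (a * (ke * x) + b)) * a := by
      rw [congrFun stationary x, ← integral_eq]
      have expand (z : ℝ) : (x - (a * (ke * x + z) + b)) * a =
          (x - (a * (ke * x) + b)) * a - a ^ 2 * z := by ring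
      have noise_term : ∫ z, a ^ 2 * z ∂ν = 0 := by rw [integral_const_mul, hmean, mul_zero]
      simp [expand, integral_sub (integrable_const _) (hid.const_mul _), noise_term]
    have hab : b * a = 0 := by linarith [value 0]
    have ha : a ≠ 0 := by
      rintro rfl
      have := value 1
      simp [hlam.ne', hke] at this
    have hb : b = 0 := (mul_eq_zero.1 hab).resolve_right ha
    exact ⟨a, fun y => by simp [hb]⟩
  · exfalso
    obtain ⟨k, hk⟩ : ∃ k, p.natDegree = k + 2 := ⟨p.natDegree - 2, by omega⟩
    have hderiv : p.derivative.natDegree ≤ k + 1 := by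
      have := p.natDegree_derivative_le
      omega
    have identity : Polynomial.C lam * Polynomial.X =
        Polynomial.C ke⁻¹ * (D * Polynomial.X) - S := by
      refine Polynomial.funext fun y => ?_
      have := congrFun stationary (ke⁻¹ * y)
      simp only [mul_inv_cancel_left₀ hke] at this
      simp only [Polynomial.eval_mul, Polynomial.eval_sub, Polynomial.eval_C, Polynomial.eval_X]
      linarith
    have hDzero : D.coeff (k + 2 + k) = 0 := by
      rw [hDcoeff _ (by omega), Polynomial.coeff_eq_zero_of_natDegree_lt (by omega)]
    have hSlead : S.coeff (k + 2 + (k + 1)) = p.coeff (k + 2) * p.derivative.coeff (k + 1) := by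
      rw [hScoeff _ (Polynomial.natDegree_mul_le.trans (by omega)),
        Polynomial.coeff_mul_add_eq_of_natDegree_le hk.le hderiv]
    have hlead : p.coeff (k + 2) ≠ 0 := by
      rw [← hk, Polynomial.coeff_natDegree, Polynomial.leadingCoeff_ne_zero]
      rintro rfl
      simp at hk
    have hX : (Polynomial.X : Polynomial ℝ).coeff (k + 2 + (k + 1)) = 0 :=
      Polynomial.coeff_X_of_ne_one (by omega)
    have hDX : (D * Polynomial.X).coeff (k + 2 + (k + 1)) = 0 := by
      rw [← add_assoc, Polynomial.coeff_mul_X, hDzero]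
    have hcoeff := congrArg (fun q => Polynomial.coeff q (k + 2 + (k + 1))) identity
    simp only [Polynomial.coeff_sub, Polynomial.coeff_C_mul, hX, hDX, hSlead,
      Polynomial.coeff_derivative, mul_zero, zero_sub] at hcoeff
    have hpos : ((k + 1 : ℕ) : ℝ) + 1 ≠ 0 := by positivity
    exact mul_ne_zero hlead (mul_ne_zero hlead hpos) (neg_eq_zero.1 hcoeff.symm)
end

section
/- Let P_T > 0, σ_X² > 0, and let ν be a probability measure on ℝ (the channel-noise law) with ∫ z dν(z) = 0 and second moment σ_Z² := ∫ z² dν(z) < ∞. Set k_e := √(P_T/σ_X²), k_d := (1/k_e)·P_T/(P_T + σ_Z²), and λ := σ_X²·σ_Z²/(P_T + σ_Z²)². Then the linear encoder g(x) = k_e·x and linear decoder h(y) = k_d·y satisfy the encoder stationarity condition for every x ∈ ℝ: λ·(k_e·x) = ∫ k_d · ( x − k_d·(k_e·x + z) ) dν(z). This holds regardless of the source and noise distributions (only zero mean and finite second moment of the noise are used). -/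
open MeasureTheory ProbabilityTheory
open scoped ENNReal NNReal

/-- Lemma 6: the linear encoder `g(x) = k_e x` and linear decoder `h(y) = k_d y` with
the scalar-Gaussian-optimal gains satisfy the encoder stationarity condition
`λ (k_e x) = ∫ k_d (x − k_d (k_e x + z)) dν(z)` for every `x`, for the Lagrange
multiplier `λ = σ_X² σ_Z² / (P_T + σ_Z²)²`, regardless of the source and noise
distributions (only zero mean and finite second moment of the noise are used). -/
theorem linear_mappings_satisfy_stationarity
    (PT σX2 σZ2 lam ke kd : ℝ) (hPT : 0 < PT) (hσX : 0 < σX2)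
    (ν : Measure ℝ) [IsProbabilityMeasure ν]
    (hint : Integrable (fun z : ℝ => z) ν)
    (hint2 : Integrable (fun z : ℝ => z ^ 2) ν)
    (hmean : ∫ z, z ∂ν = 0)
    (hσZ : σZ2 = ∫ z, z ^ 2 ∂ν)
    (hke : ke = Real.sqrt (PT / σX2))
    (hkd : kd = (1 / ke) * (PT / (PT + σZ2)))
    (hlam : lam = σX2 * σZ2 / (PT + σZ2) ^ 2) :
    ∀ x : ℝ, lam * (ke * x) = ∫ z, kd * (x - kd * (ke * x + z)) ∂ν := by
  intro x
  have hZ : 0 ≤ σZ2 := hσZ ▸ integral_nonneg fun z => sq_nonneg z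
  have hke_pos : 0 < ke := hke ▸ Real.sqrt_pos.mpr (div_pos hPT hσX)
  have hPT_eq : PT = ke ^ 2 * σX2 := by
    rw [hke, Real.sq_sqrt (div_pos hPT hσX).le, div_mul_cancel₀ _ hσX.ne']
  have hsum : PT + σZ2 ≠ 0 := by positivity
  have hintegral : ∫ z, kd * (x - kd * (ke * x + z)) ∂ν = kd * (x - kd * (ke * x)) := by
    have hlin : ∀ z : ℝ, kd * (x - kd * (ke * x + z)) =
        kd * (x - kd * (ke * x)) - kd ^ 2 * z := fun z => by ring
    simp_rw [hlin]
    rw [integral_sub (integrable_const _) (hint.const_mul _), integral_const,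
      integral_const_mul, hmean]
    simp
  have hgain : kd * ke = PT / (PT + σZ2) := by
    rw [hkd]
    field_simp
  have hresidual : x - kd * (ke * x) = σZ2 / (PT + σZ2) * x := by
    rw [← mul_assoc, hgain]
    field_simp
    ring
  rw [hintegral, hresidual, hkd, hlam]
  field_simp
  rw [hPT_eq]
  ring
end

section
/- Let λ > 0, and let ν be a probability measure on ℝ with all moments finite and ∫ z dν(z) = 0. Let g : ℝ → ℝ be Borel measurable and let h : ℝ → ℝ be a polynomial function, and suppose they satisfy, for Lebesgue-almost every x ∈ ℝ, the encoder stationarity condition λ·g(x) = ∫ h'(g(x)+z)·( x − h(g(x)+z) ) dν(z). Then the following are equivalent: (i) there exists k_d ≠ 0 such that h(y) = k_d·y for all y; (ii) there exists k_e ≠ 0 such that g(x) = k_e·x for Lebesgue-almost every x. -/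
open MeasureTheory ProbabilityTheory
open scoped ENNReal NNReal

open Polynomial in
/-- Averaging a polynomial over translates by a probability measure with finite moments gives a
polynomial with the same coefficients from the degree upwards. -/
theorem exists_polynomial_integral_translate
    (ν : Measure ℝ) [IsProbabilityMeasure ν]
    (hmom : ∀ n : ℕ, Integrable (fun z : ℝ => z ^ n) ν) (q : ℝ[X]) :
    ∃ Q : ℝ[X], (∀ y, Integrable (fun z => q.eval (y + z)) ν ∧
        ∫ z, q.eval (y + z) ∂ν = Q.eval y) ∧
      ∀ n, q.natDegree ≤ n → Q.coeff n = q.coeff n := by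
  have hexp : ∀ y z : ℝ, q.eval (y + z) =
      ∑ k ∈ Finset.range (q.natDegree + 1), (hasseDeriv k q).eval y * z ^ k := by
    intro y z
    have h : q.eval (y + z) = (taylor y q).eval z := by
      rw [taylor_eval, add_comm]
    rw [h, eval_eq_sum_range, natDegree_taylor]
    simp only [taylor_coeff]
  have hint : ∀ y : ℝ, ∀ k ∈ Finset.range (q.natDegree + 1),
      Integrable (fun z : ℝ => (hasseDeriv k q).eval y * z ^ k) ν :=
    fun y k _ => (hmom k).const_mul _
  refine ⟨∑ k ∈ Finset.range (q.natDegree + 1), C (∫ z, z ^ k ∂ν) * hasseDeriv k q,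
    fun y => ⟨?_, ?_⟩, fun n hn => ?_⟩
  · simp only [hexp]
    exact integrable_finsetSum _ (hint y)
  · simp only [hexp]
    rw [integral_finsetSum _ (hint y), eval_finsetSum]
    refine Finset.sum_congr rfl fun k _ => ?_
    rw [integral_const_mul, eval_mul, eval_C, mul_comm]
  · rw [finsetSum_coeff, Finset.sum_range_succ', Finset.sum_eq_zero]
    · simp
    · intro k _
      rw [coeff_C_mul, hasseDeriv_coeff, coeff_eq_zero_of_natDegree_lt (by omega)]
      simp

open Polynomial in
/-- A polynomial decoder satisfying the stationarity condition against a linear encoder has degree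
at most one. -/
theorem natDegree_le_one_of_stationary
    (lam : ℝ) (ν : Measure ℝ) [IsProbabilityMeasure ν]
    (hmom : ∀ n : ℕ, Integrable (fun z : ℝ => z ^ n) ν)
    (ke : ℝ) (hke : ke ≠ 0) (p : ℝ[X])
    (hstat : ∀ᵐ x ∂(volume : Measure ℝ), lam * (ke * x) =
      ∫ z, p.derivative.eval (ke * x + z) * (x - p.eval (ke * x + z)) ∂ν) :
    p.natDegree ≤ 1 := by
  by_contra! hdeg
  obtain ⟨Q₁, hQ₁, hcoeff₁⟩ := exists_polynomial_integral_translate ν hmom p.derivative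
  obtain ⟨Q₂, hQ₂, hcoeff₂⟩ := exists_polynomial_integral_translate ν hmom (p.derivative * p)
  have hsplit : ∀ x : ℝ,
      ∫ z, p.derivative.eval (ke * x + z) * (x - p.eval (ke * x + z)) ∂ν =
        x * Q₁.eval (ke * x) - Q₂.eval (ke * x) := by
    intro x
    rw [← (hQ₁ (ke * x)).2, ← (hQ₂ (ke * x)).2, ← integral_const_mul,
      ← integral_sub ((hQ₁ (ke * x)).1.const_mul x) (hQ₂ (ke * x)).1]
    congr 1 with z
    rw [eval_mul]
    ring
  have heq : (fun x : ℝ => lam * (ke * x)) =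
      fun x => x * Q₁.eval (ke * x) - Q₂.eval (ke * x) := by
    refine (Continuous.ae_eq_iff_eq (volume : Measure ℝ) (by fun_prop) (by fun_prop)).1 ?_
    filter_upwards [hstat] with x hx
    rw [hx, hsplit]
  have hpoly : C lam * X = C ke⁻¹ * (X * Q₁) - Q₂ := by
    refine Polynomial.funext fun y => ?_
    have h := congrFun heq (ke⁻¹ * y)
    simp only [mul_inv_cancel_left₀ hke] at h
    simp only [eval_mul, eval_sub, eval_C, eval_X]
    rw [h, mul_assoc]
  have hder : p.derivative.natDegree = p.natDegree - 1 := natDegree_derivative p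
  have hp : p ≠ 0 := by
    rintro rfl
    simp at hdeg
  have hp' : p.derivative ≠ 0 := by
    intro h
    rw [h, natDegree_zero] at hder
    omega
  have hc := congrArg (fun r => coeff r (p.derivative.natDegree + p.natDegree)) hpoly
  obtain ⟨m, hm⟩ : ∃ m, p.derivative.natDegree + p.natDegree = m + 1 :=
    ⟨p.derivative.natDegree + p.natDegree - 1, by omega⟩
  simp only [coeff_sub, coeff_C_mul] at hc
  rw [hcoeff₂ _ natDegree_mul_le, coeff_mul_degree_add_degree, hm, coeff_X_mul,
    hcoeff₁ m (by omega), coeff_X_of_ne_one (by omega),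
    coeff_eq_zero_of_natDegree_lt (by omega)] at hc
  have : p.derivative.leadingCoeff * p.leadingCoeff = 0 := by linarith
  exact mul_ne_zero (leadingCoeff_ne_zero.2 hp') (leadingCoeff_ne_zero.2 hp) this

/-- The stationarity integral of an affine decoder. -/
theorem integral_affine_stationary
    (ν : Measure ℝ) [IsProbabilityMeasure ν]
    (hint : Integrable (fun z : ℝ => z) ν) (hmean : ∫ z, z ∂ν = 0) (a b x y : ℝ) :
    ∫ z, a * (x - (a * (y + z) + b)) ∂ν = a * (x - (a * y + b)) := by
  have h : (fun z : ℝ => a * (x - (a * (y + z) + b))) =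
      fun z => a * (x - (a * y + b)) - a ^ 2 * z := by
    funext z
    ring
  rw [h, integral_sub (integrable_const _) (hint.const_mul _), integral_const_mul (a ^ 2), hmean]
  simp

/-- Theorem 4: for a measurable encoder `g` and a polynomial decoder `h = p.eval`
jointly satisfying the encoder stationarity condition (with zero-mean noise having all
moments finite), the decoder is linear if and only if the encoder is linear (a.e.):
they are either both linear or both nonlinear. -/
theorem encoder_linear_iff_decoder_linear
    (lam : ℝ) (hlam : 0 < lam)
    (ν : Measure ℝ) [IsProbabilityMeasure ν]
    (hmom : ∀ n : ℕ, Integrable (fun z : ℝ => z ^ n) ν)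
    (hmean : ∫ z, z ∂ν = 0)
    (g : ℝ → ℝ) (hg : Measurable g) (p : Polynomial ℝ)
    (hstat : ∀ᵐ x ∂(volume : Measure ℝ),
      lam * g x =
        ∫ z, p.derivative.eval (g x + z) * (x - p.eval (g x + z)) ∂ν) :
    (∃ kd : ℝ, kd ≠ 0 ∧ ∀ y : ℝ, p.eval y = kd * y) ↔
      (∃ ke : ℝ, ke ≠ 0 ∧ ∀ᵐ x ∂(volume : Measure ℝ), g x = ke * x) := by
  have hint : Integrable (fun z : ℝ => z) ν := by simpa using hmom 1
  constructor
  · rintro ⟨kd, hkd, hp⟩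
    have hpC : p = Polynomial.C kd * Polynomial.X := Polynomial.funext fun y => by simp [hp]
    have hpos : 0 < lam + kd ^ 2 := by positivity
    refine ⟨kd / (lam + kd ^ 2), div_ne_zero hkd hpos.ne', ?_⟩
    filter_upwards [hstat] with x hx
    have hx' := integral_affine_stationary ν hint hmean kd 0 x (g x)
    simp only [hpC, Polynomial.derivative_C_mul_X, Polynomial.eval_C, Polynomial.eval_mul,
      Polynomial.eval_X] at hx
    simp only [add_zero] at hx'
    rw [hx'] at hx
    field_simp
    linarith
  · rintro ⟨ke, hke, hgke⟩
    have hlin : ∀ᵐ x ∂(volume : Measure ℝ), lam * (ke * x) =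
        ∫ z, p.derivative.eval (ke * x + z) * (x - p.eval (ke * x + z)) ∂ν := by
      filter_upwards [hstat, hgke] with x hx hgx
      rwa [hgx] at hx
    obtain ⟨a, b, rfl⟩ := Polynomial.exists_eq_X_add_C_of_natDegree_le_one
      (natDegree_le_one_of_stationary lam ν hmom ke hke p hlin)
    have heq : (fun x : ℝ => lam * (ke * x)) = fun x => a * (x - (a * (ke * x) + b)) := by
      refine (Continuous.ae_eq_iff_eq (volume : Measure ℝ) (by fun_prop) (by fun_prop)).1 ?_
      filter_upwards [hlin] with x hx
      rw [hx, ← integral_affine_stationary ν hint hmean]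
      simp
    have h0 : a * b = 0 := by
      have := congrFun heq 0
      simp only [mul_zero] at this
      linarith
    have ha : a ≠ 0 := by
      rintro rfl
      have := congrFun heq 1
      simp [hlam.ne', hke] at this
    have hb : b = 0 := (mul_eq_zero.1 h0).resolve_left ha
    exact ⟨a, ha, fun y => by simp [hb]⟩
end
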